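/- Let (k_1, k_1^{-1}, e_1, f_1, k_2, k_2^{-1}, e_2, f_2) be a module-algebra structure of U_q(sl(3)) on the quantum 3-space A_q(3) with k_1(x_1) = q⁻²x_1, k_1(x_2) = q⁻¹x_2, k_1(x_3) = q⁻¹x_3, k_2(x_1) = qx_1, k_2(x_2) = qx_2, k_2(x_3) = q²x_3. Then there exist a₀, f₀ ∈ ℂ∖{0} such that e_1(x_1) = a₀·1, e_1(x_2) = e_1(x_3) = 0, e_2(x_1) = −qf₀⁻¹x_1x_3, e_2(x_2) = −qf₀⁻¹x_2x_3, e_2(x_3) = −qf₀⁻¹x_3², f_1(x_1) = −qa₀⁻¹x_1², f_1(x_2) = −qa₀⁻¹x_1x_2, f_1(x_3) = −qa₀⁻¹x_1x_3, f_2(x_1) = f_2(x_2) = 0, f_2(x_3) = f₀·1. Conversely, each such assignment defines a module-algebra structure of U_q(sl(3)) on A_q(3), and every such structure is isomorphic to the one with a₀ = f₀ = 1. -/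

import Mathlib

noncomputable section

open scoped BigOperators

/-- The defining relations of the quantum `n`-space `A_q(n)`:
`x_i x_j = q • (x_j x_i)` for `i > j`. -/
inductive QRel (q : ℂ) (n : ℕ) : FreeAlgebra ℂ (Fin n) → FreeAlgebra ℂ (Fin n) → Prop
  | rel (i j : Fin n) (h : j < i) :
      QRel q n (FreeAlgebra.ι ℂ i * FreeAlgebra.ι ℂ j)
        (q • (FreeAlgebra.ι ℂ j * FreeAlgebra.ι ℂ i))

/-- The quantum `n`-space `A_q(n)`. -/
abbrev QSpace (q : ℂ) (n : ℕ) : Type := RingQuot (QRel q n)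

/-- The generator `x_i` of the quantum `n`-space. -/
def Xg (q : ℂ) (n : ℕ) (i : Fin n) : QSpace q n :=
  RingQuot.mkAlgHom ℂ (QRel q n) (FreeAlgebra.ι ℂ i)

/-- The Cartan matrix of `sl(m+1)`: `a_{ii} = 2`, `a_{ij} = -1` if `|i-j| = 1`,
`a_{ij} = 0` if `|i-j| > 1`. -/
def cartan (m : ℕ) (i j : Fin m) : ℤ :=
  if i = j then 2 else if ((i : ℤ) - (j : ℤ)).natAbs = 1 then -1 else 0

/-- A module-algebra structure of `U_q(sl(m+1))` on a unital `ℂ`-algebra `A`: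
`ℂ`-linear maps `k_i` (unital algebra automorphisms with two-sided inverses `(k i).symm`),
`e_i`, `f_i` for `1 ≤ i ≤ m`, satisfying the twisted Leibniz rules and the defining
operator relations of `U_q(sl(m+1))`. -/
structure UqslMA (q : ℂ) (m : ℕ) (A : Type) [Ring A] [Algebra ℂ A] where
  k : Fin m → (A ≃ₐ[ℂ] A)
  e : Fin m → (A →ₗ[ℂ] A)
  f : Fin m → (A →ₗ[ℂ] A)
  e_mul : ∀ (i : Fin m) (a b : A), e i (a * b) = a * e i b + e i a * k i b
  f_mul : ∀ (i : Fin m) (a b : A), f i (a * b) = (k i).symm a * f i b + f i a * b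
  e_one : ∀ i : Fin m, e i 1 = 0
  f_one : ∀ i : Fin m, f i 1 = 0
  k_comm : ∀ (i j : Fin m) (a : A), k i (k j a) = k j (k i a)
  ke : ∀ (i j : Fin m) (a : A), k i (e j ((k i).symm a)) = q ^ cartan m i j • e j a
  kf : ∀ (i j : Fin m) (a : A), k i (f j ((k i).symm a)) = q ^ (-cartan m i j) • f j a
  ef : ∀ (i j : Fin m) (a : A),
      e i (f j a) - f j (e i a) =
        if i = j then (q - q⁻¹)⁻¹ • (k i a - (k i).symm a) else 0
  ee_comm : ∀ i j : Fin m, cartan m i j = 0 → ∀ a : A, e i (e j a) = e j (e i a)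
  ff_comm : ∀ i j : Fin m, cartan m i j = 0 → ∀ a : A, f i (f j a) = f j (f i a)
  serre_e : ∀ i j : Fin m, cartan m i j = -1 → ∀ a : A,
      e i (e i (e j a)) - (q + q⁻¹) • e i (e j (e i a)) + e j (e i (e i a)) = 0
  serre_f : ∀ i j : Fin m, cartan m i j = -1 → ∀ a : A,
      f i (f i (f j a)) - (q + q⁻¹) • f i (f j (f i a)) + f j (f i (f i a)) = 0

/-- Isomorphism of module-algebra structures: an algebra automorphism `ψ` of `A` with
`ψ ∘ π₁(h) ∘ ψ⁻¹ = π₂(h)` for every generator `h ∈ {k_i^{±1}, e_i, f_i}`. -/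
def UqslMA.Iso {q : ℂ} {m : ℕ} {A : Type} [Ring A] [Algebra ℂ A]
    (π₁ π₂ : UqslMA q m A) : Prop :=
  ∃ ψ : A ≃ₐ[ℂ] A,
    (∀ (i : Fin m) (a : A), ψ (π₁.k i (ψ.symm a)) = π₂.k i a) ∧
    (∀ (i : Fin m) (a : A), ψ ((π₁.k i).symm (ψ.symm a)) = (π₂.k i).symm a) ∧
    (∀ (i : Fin m) (a : A), ψ (π₁.e i (ψ.symm a)) = π₂.e i a) ∧
    (∀ (i : Fin m) (a : A), ψ (π₁.f i (ψ.symm a)) = π₂.f i a)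

/-- The generator `x_1` of the quantum 3-space. -/
def Z1 (q : ℂ) : QSpace q 3 := Xg q 3 0
/-- The generator `x_2` of the quantum 3-space. -/
def Z2 (q : ℂ) : QSpace q 3 := Xg q 3 1
/-- The generator `x_3` of the quantum 3-space. -/
def Z3 (q : ℂ) : QSpace q 3 := Xg q 3 2

/-- The `k`-action of case `(A2)|(B3)`. -/
def KCond12 (q : ℂ) (π : UqslMA q 2 (QSpace q 3)) : Prop :=
  π.k 0 (Z1 q) = (q ^ (-2 : ℤ)) • Z1 q ∧ π.k 0 (Z2 q) = q⁻¹ • Z2 q ∧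
  π.k 0 (Z3 q) = q⁻¹ • Z3 q ∧
  π.k 1 (Z1 q) = q • Z1 q ∧ π.k 1 (Z2 q) = q • Z2 q ∧
  π.k 1 (Z3 q) = (q ^ (2 : ℕ)) • Z3 q

/-- The `e`/`f`-action of case `(A2)|(B3)` with parameters `a₀`, `f₀`. -/
def EFDesc12 (q : ℂ) (π : UqslMA q 2 (QSpace q 3)) (a₀ f₀ : ℂ) : Prop :=
  π.e 0 (Z1 q) = a₀ • 1 ∧ π.e 0 (Z2 q) = 0 ∧ π.e 0 (Z3 q) = 0 ∧
  π.e 1 (Z1 q) = (-q * f₀⁻¹) • (Z1 q * Z3 q) ∧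
  π.e 1 (Z2 q) = (-q * f₀⁻¹) • (Z2 q * Z3 q) ∧
  π.e 1 (Z3 q) = (-q * f₀⁻¹) • (Z3 q ^ 2) ∧
  π.f 0 (Z1 q) = (-q * a₀⁻¹) • (Z1 q ^ 2) ∧
  π.f 0 (Z2 q) = (-q * a₀⁻¹) • (Z1 q * Z2 q) ∧
  π.f 0 (Z3 q) = (-q * a₀⁻¹) • (Z1 q * Z3 q) ∧
  π.f 1 (Z1 q) = 0 ∧ π.f 1 (Z2 q) = 0 ∧ π.f 1 (Z3 q) = f₀ • 1

namespace QSpace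

/-- Universal property of the quantum `n`-space. -/
def lift {q : ℂ} {n : ℕ} {B : Type} [Ring B] [Algebra ℂ B] (y : Fin n → B)
    (h : ∀ i j, j < i → y i * y j = q • (y j * y i)) : QSpace q n →ₐ[ℂ] B :=
  RingQuot.liftAlgHom ℂ ⟨FreeAlgebra.lift ℂ y, by
    rintro _ _ ⟨i, j, hij⟩
    simpa using h i j hij⟩

@[simp]
theorem lift_Xg {q : ℂ} {n : ℕ} {B : Type} [Ring B] [Algebra ℂ B] (y : Fin n → B)
    (h : ∀ i j, j < i → y i * y j = q • (y j * y i)) (i : Fin n) :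
    lift y h (Xg q n i) = y i := by
  simp [lift, Xg]

theorem Xg_mul_Xg (q : ℂ) {n : ℕ} {i j : Fin n} (h : j < i) :
    Xg q n i * Xg q n j = q • (Xg q n j * Xg q n i) := by
  have := RingQuot.mkAlgHom_rel ℂ (QRel.rel (q := q) i j h)
  simpa [Xg] using this

@[elab_as_elim]
theorem induction {q : ℂ} {n : ℕ} {P : QSpace q n → Prop}
    (scalar : ∀ c : ℂ, P (algebraMap ℂ _ c)) (gen : ∀ i, P (Xg q n i))
    (mul : ∀ a b, P a → P b → P (a * b)) (add : ∀ a b, P a → P b → P (a + b))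
    (u : QSpace q n) : P u := by
  obtain ⟨w, rfl⟩ := RingQuot.mkAlgHom_surjective ℂ (QRel q n) u
  induction w using FreeAlgebra.induction with
  | grade0 r => simpa using scalar r
  | grade1 i => exact gen i
  | mul a b ha hb => simpa using mul _ _ ha hb
  | add a b ha hb => simpa using add _ _ ha hb

/-- A linear map satisfying a twisted Leibniz rule and vanishing on the generators is zero. -/
theorem skewDerivation_eq_zero {q : ℂ} {n : ℕ} (σ τ D : QSpace q n → QSpace q n)
    (hadd : ∀ a b, D (a + b) = D a + D b) (hscalar : ∀ c : ℂ, D (algebraMap ℂ _ c) = 0)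
    (hmul : ∀ a b, D (a * b) = σ a * D b + D a * τ b) (hgen : ∀ i, D (Xg q n i) = 0)
    (u : QSpace q n) : D u = 0 := by
  induction u using QSpace.induction with
  | scalar c => exact hscalar c
  | gen i => exact hgen i
  | mul a b ha hb => simp [hmul, ha, hb]
  | add a b ha hb => simp [hadd, ha, hb]

/-- Skew derivations of the quantum space with prescribed values on the generators. -/
theorem exists_skewDerivation {q : ℂ} {n : ℕ} (σ τ : QSpace q n →ₐ[ℂ] QSpace q n)
    (d : Fin n → QSpace q n)
    (h : ∀ i j, j < i → σ (Xg q n i) * d j + d i * τ (Xg q n j) =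
      q • (σ (Xg q n j) * d i + d j * τ (Xg q n i))) :
    ∃ D : QSpace q n →ₗ[ℂ] QSpace q n, (∀ i, D (Xg q n i) = d i) ∧
      ∀ a b, D (a * b) = σ a * D b + D a * τ b := by
  let y : Fin n → Matrix (Fin 2) (Fin 2) (QSpace q n) := fun i =>
    !![σ (Xg q n i), d i; 0, τ (Xg q n i)]
  have hy : ∀ i j, j < i → y i * y j = q • (y j * y i) := by
    intro i j hij
    have h1 := congrArg σ (Xg_mul_Xg q hij)
    have h2 := congrArg τ (Xg_mul_Xg q hij)
    simp only [map_mul, map_smul] at h1 h2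
    ext r s
    fin_cases r <;> fin_cases s <;> simp [y, Matrix.mul_apply, h1, h2]
    simpa using h i j hij
  let Φ := lift y hy
  have h0 : ∀ u, Φ u 0 0 = σ u ∧ Φ u 1 0 = 0 ∧ Φ u 1 1 = τ u := by
    intro u
    induction u using QSpace.induction with
    | scalar c => simp [Matrix.algebraMap_matrix_apply]
    | gen i => simp [Φ, y]
    | mul a b ha hb => simp [Matrix.mul_apply, ha, hb]
    | add a b ha hb => simp [ha, hb]
  refine ⟨⟨⟨fun u => Φ u 0 1, by simp⟩, by simp⟩, by simp [Φ, y], ?_⟩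
  intro a b
  simp [Matrix.mul_apply, h0]

/-- The diagonal automorphism `x_i ↦ c_i x_i`. -/
def diag (q : ℂ) {n : ℕ} (c : Fin n → ℂˣ) : QSpace q n ≃ₐ[ℂ] QSpace q n :=
  have h (c : Fin n → ℂˣ) (i j : Fin n) (hij : j < i) :
      ((c i : ℂ) • Xg q n i) * ((c j : ℂ) • Xg q n j) =
        q • (((c j : ℂ) • Xg q n j) * ((c i : ℂ) • Xg q n i)) := by
    simp only [smul_mul_smul_comm, Xg_mul_Xg q hij]
    module
  have hinv (c c' : Fin n → ℂˣ) (hc : ∀ i, c i * c' i = 1) :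
      (lift _ (h c)).comp (lift _ (h c')) = AlgHom.id ℂ _ := by
    apply AlgHom.ext
    intro u
    induction u using QSpace.induction with
    | scalar c => simp
    | gen i =>
      have := congrArg Units.val (hc i)
      simp only [Units.val_mul, Units.val_one] at this
      simp [smul_smul, mul_comm, this]
    | mul a b ha hb => simpa using congrArg₂ (· * ·) ha hb
    | add a b ha hb => simpa using congrArg₂ (· + ·) ha hb
  AlgEquiv.ofAlgHom (lift _ (h c)) (lift _ (h c⁻¹)) (hinv _ _ (by simp)) (hinv _ _ (by simp))

@[simp]
theorem diag_Xg (q : ℂ) {n : ℕ} (c : Fin n → ℂˣ) (i : Fin n) :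
    diag q c (Xg q n i) = (c i : ℂ) • Xg q n i := by
  simp [diag]

@[simp]
theorem diag_symm_Xg (q : ℂ) {n : ℕ} (c : Fin n → ℂˣ) (i : Fin n) :
    (diag q c).symm (Xg q n i) = (c i : ℂ)⁻¹ • Xg q n i := by
  simp [AlgEquiv.symm_apply_eq]

theorem algHom_ext_Xg {q : ℂ} {n : ℕ} {B : Type} [Ring B] [Algebra ℂ B]
    {φ ψ : QSpace q n →ₐ[ℂ] B} (h : ∀ i, φ (Xg q n i) = ψ (Xg q n i)) : φ = ψ := by
  apply AlgHom.ext
  intro u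
  induction u using QSpace.induction with
  | scalar c => simp
  | gen i => exact h i
  | mul a b ha hb => simp [ha, hb]
  | add a b ha hb => simp [ha, hb]

theorem Z2_mul_Z1 (q : ℂ) : Z2 q * Z1 q = q • (Z1 q * Z2 q) := Xg_mul_Xg q (by decide)
theorem Z3_mul_Z1 (q : ℂ) : Z3 q * Z1 q = q • (Z1 q * Z3 q) := Xg_mul_Xg q (by decide)
theorem Z3_mul_Z2 (q : ℂ) : Z3 q * Z2 q = q • (Z2 q * Z3 q) := Xg_mul_Xg q (by decide)

theorem Z2_mul_Z1_mul (q : ℂ) (w : QSpace q 3) :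
    Z2 q * (Z1 q * w) = q • (Z1 q * (Z2 q * w)) := by
  rw [← mul_assoc, Z2_mul_Z1, smul_mul_assoc, mul_assoc]
theorem Z3_mul_Z1_mul (q : ℂ) (w : QSpace q 3) :
    Z3 q * (Z1 q * w) = q • (Z1 q * (Z3 q * w)) := by
  rw [← mul_assoc, Z3_mul_Z1, smul_mul_assoc, mul_assoc]
theorem Z3_mul_Z2_mul (q : ℂ) (w : QSpace q 3) :
    Z3 q * (Z2 q * w) = q • (Z2 q * (Z3 q * w)) := by
  rw [← mul_assoc, Z3_mul_Z2, smul_mul_assoc, mul_assoc]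

/-- The ordered monomial `x_1^a x_2^b x_3^c`. -/
def monomial (q : ℂ) (m : ℕ × ℕ × ℕ) : QSpace q 3 :=
  Z1 q ^ m.1 * Z2 q ^ m.2.1 * Z3 q ^ m.2.2

theorem mul_pow_of_qcomm {q : ℂ} {A : Type} [Ring A] [Algebra ℂ A] {x y : A}
    (h : y * x = q • (x * y)) (a : ℕ) : y * x ^ a = q ^ a • (x ^ a * y) := by
  induction a with
  | zero => simp
  | succ a ih =>
    rw [pow_succ, ← mul_assoc, ih, smul_mul_assoc, mul_assoc, h, mul_smul_comm, smul_smul,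
      mul_assoc, pow_succ]

/-- The operators by which the generators act on ordered monomials from the left. -/
def leftMulOp (q : ℂ) : Fin 3 → Module.End ℂ (ℕ × ℕ × ℕ →₀ ℂ) :=
  ![Finsupp.linearCombination ℂ fun m => Finsupp.single (m.1 + 1, m.2.1, m.2.2) 1,
    Finsupp.linearCombination ℂ fun m => Finsupp.single (m.1, m.2.1 + 1, m.2.2) (q ^ m.1),
    Finsupp.linearCombination ℂ fun m =>
      Finsupp.single (m.1, m.2.1, m.2.2 + 1) (q ^ (m.1 + m.2.1))]

/-- The action of the quantum 3-space on the space spanned by the ordered monomials. -/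
def leftMulRep (q : ℂ) : QSpace q 3 →ₐ[ℂ] Module.End ℂ (ℕ × ℕ × ℕ →₀ ℂ) :=
  lift (leftMulOp q) <| by
    intro i j hij
    ext m : 2
    fin_cases i <;> fin_cases j <;> simp at hij <;>
      simp [leftMulOp, -Finsupp.single_mul] <;> (congr 1; ring)

theorem linearCombination_monomial_leftMulRep (q : ℂ) (u : QSpace q 3) (v : ℕ × ℕ × ℕ →₀ ℂ) :
    Finsupp.linearCombination ℂ (monomial q) (leftMulRep q u v) =
      u * Finsupp.linearCombination ℂ (monomial q) v := by
  induction u using QSpace.induction generalizing v with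
  | scalar c => simp [Algebra.smul_def]
  | mul a b ha hb => simp [ha, hb, mul_assoc]
  | add a b ha hb => simp [ha, hb, add_mul]
  | gen i =>
    induction v using Finsupp.induction_linear with
    | zero => simp
    | add v w hv hw => simp only [map_add, hv, hw, mul_add]
    | single m r =>
      have h21 := mul_pow_of_qcomm (Z2_mul_Z1 q) m.1
      have h31 := mul_pow_of_qcomm (Z3_mul_Z1 q) m.1
      have h32 := mul_pow_of_qcomm (Z3_mul_Z2 q) m.2.1
      have key : Finsupp.linearCombination ℂ (monomial q)
          (leftMulOp q i (Finsupp.single m 1)) = Xg q 3 i * monomial q m := by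
        fin_cases i
        · change _ = Z1 q * _
          simp [leftMulOp, monomial, pow_succ', mul_assoc]
        · change _ = Z2 q * _
          simp [leftMulOp, monomial, pow_succ', ← mul_assoc, h21]
        · change _ = Z3 q * _
          simp only [monomial, ← mul_assoc, h31, smul_mul_assoc]
          simp only [mul_assoc _ (Z3 q), h32]
          simp [leftMulOp, monomial, pow_succ', mul_assoc, smul_smul, pow_add,
            -Finsupp.single_mul]
      have hs : Finsupp.single m r = r • Finsupp.single m (1 : ℂ) := by simp
      rw [hs, map_smul, map_smul, map_smul, mul_smul_comm, leftMulRep, lift_Xg, key]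
      simp

theorem leftMulRep_monomial (q : ℂ) (m : ℕ × ℕ × ℕ) :
    leftMulRep q (monomial q m) (Finsupp.single 0 1) = Finsupp.single m 1 := by
  have h1 : leftMulRep q (Z1 q) = leftMulOp q 0 := lift_Xg _ _ _
  have h2 : leftMulRep q (Z2 q) = leftMulOp q 1 := lift_Xg _ _ _
  have h3 : leftMulRep q (Z3 q) = leftMulOp q 2 := lift_Xg _ _ _
  obtain ⟨a, b, c⟩ := m
  have hc : (leftMulOp q 2 ^ c) (Finsupp.single 0 1) = Finsupp.single (0, 0, c) 1 := by
    induction c with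
    | zero => rfl
    | succ c ih => rw [pow_succ', Module.End.mul_apply, ih]; simp [leftMulOp]
  have hb : (leftMulOp q 1 ^ b) (Finsupp.single (0, 0, c) 1) = Finsupp.single (0, b, c) 1 := by
    induction b with
    | zero => rfl
    | succ c ih => rw [pow_succ', Module.End.mul_apply, ih]; simp [leftMulOp]
  have ha : (leftMulOp q 0 ^ a) (Finsupp.single (0, b, c) 1) = Finsupp.single (a, b, c) 1 := by
    induction a with
    | zero => rfl
    | succ c ih => rw [pow_succ', Module.End.mul_apply, ih]; simp [leftMulOp]
  simp only [monomial, map_mul, map_pow, h1, h2, h3, Module.End.mul_apply, hc, hb, ha]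

/-- The ordered monomials form a basis of the quantum 3-space. -/
def monomialBasis (q : ℂ) : Module.Basis (ℕ × ℕ × ℕ) ℂ (QSpace q 3) :=
  Module.Basis.ofRepr <| LinearEquiv.ofLinearMap
    ((LinearMap.applyₗ (Finsupp.single 0 1)).comp (leftMulRep q).toLinearMap)
    (Finsupp.linearCombination ℂ (monomial q))
    (by ext m : 2; simp [leftMulRep_monomial])
    (by
      ext u
      simpa [monomial] using linearCombination_monomial_leftMulRep q u (Finsupp.single 0 1))

@[simp]
theorem monomialBasis_apply (q : ℂ) (m : ℕ × ℕ × ℕ) : monomialBasis q m = monomial q m := by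
  simp [monomialBasis]

theorem monomial_ne_zero (q : ℂ) (m : ℕ × ℕ × ℕ) : monomial q m ≠ 0 := by
  rw [← monomialBasis_apply]
  exact (monomialBasis q).ne_zero m

theorem eq_sum_monomial {q : ℂ} {u : QSpace q 3} (S : Finset (ℕ × ℕ × ℕ))
    (h : ∀ m, (monomialBasis q).repr u m ≠ 0 → m ∈ S) :
    u = ∑ m ∈ S, (monomialBasis q).repr u m • monomial q m := by
  conv_lhs => rw [← (monomialBasis q).linearCombination_repr u, Finsupp.linearCombination_apply]
  rw [Finsupp.sum_of_support_subset _ (s := S) (fun m hm => h m (by simpa using hm)) _ (by simp)]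
  simp

theorem repr_of_eigenvector {q : ℂ} (k : QSpace q 3 →ₗ[ℂ] QSpace q 3) (w : ℕ × ℕ × ℕ → ℂ)
    (hk : ∀ m, k (monomial q m) = w m • monomial q m) {u : QSpace q 3} {c : ℂ}
    (hu : k u = c • u) (m : ℕ × ℕ × ℕ) (hm : (monomialBasis q).repr u m ≠ 0) : w m = c := by
  have hk' (j) : k (monomialBasis q j) = w j • monomialBasis q j := by simpa using hk j
  have key : ((monomialBasis q).coord m).comp k = w m • (monomialBasis q).coord m := by
    apply (monomialBasis q).ext
    intro j
    by_cases hj : j = m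
    · subst hj; simp [hk', -monomialBasis_apply]
    · simp [hk', -monomialBasis_apply, hj]
  have := LinearMap.congr_fun key u
  simp [hu] at this
  exact (this.resolve_right hm).symm

/-- A module-algebra structure is determined by skew derivations satisfying the defining
relations on the generators. -/
theorem exists_uqslMA {q : ℂ} (hq : q ≠ 0) {m n : ℕ} (k : Fin m → (QSpace q n ≃ₐ[ℂ] QSpace q n))
    (e f : Fin m → (QSpace q n →ₗ[ℂ] QSpace q n))
    (e_mul : ∀ i a b, e i (a * b) = a * e i b + e i a * k i b)
    (f_mul : ∀ i a b, f i (a * b) = (k i).symm a * f i b + f i a * b)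
    (hk : ∀ i j t, k i (k j (Xg q n t)) = k j (k i (Xg q n t)))
    (hke : ∀ i j t, k i (e j (Xg q n t)) = q ^ cartan m i j • e j (k i (Xg q n t)))
    (hkf : ∀ i j t, k i (f j (Xg q n t)) = q ^ (-cartan m i j) • f j (k i (Xg q n t)))
    (hef : ∀ i j t, e i (f j (Xg q n t)) - f j (e i (Xg q n t)) =
      if i = j then (q - q⁻¹)⁻¹ • (k i (Xg q n t) - (k i).symm (Xg q n t)) else 0)
    (hcartan : ∀ i j, cartan m i j ≠ 0)
    (he : ∀ i j, cartan m i j = -1 → ∀ t, e i (e i (e j (Xg q n t))) -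
      (q + q⁻¹) • e i (e j (e i (Xg q n t))) + e j (e i (e i (Xg q n t))) = 0)
    (hf : ∀ i j, cartan m i j = -1 → ∀ t, f i (f i (f j (Xg q n t))) -
      (q + q⁻¹) • f i (f j (f i (Xg q n t))) + f j (f i (f i (Xg q n t))) = 0) :
    ∃ π : UqslMA q m (QSpace q n), π.k = k ∧ π.e = e ∧ π.f = f := by
  have hsymm : ∀ i j, cartan m i j = cartan m j i := by
    intro i j
    simp only [cartan, eq_comm (a := i), ← Int.natAbs_neg ((i : ℤ) - j), neg_sub]
  have e_one : ∀ i, e i 1 = 0 := fun i => by simpa using e_mul i 1 1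
  have f_one : ∀ i, f i 1 = 0 := fun i => by simpa using f_mul i 1 1
  have e_alg : ∀ i (c : ℂ), e i (algebraMap ℂ _ c) = 0 := fun i c => by
    simp [Algebra.algebraMap_eq_smul_one, e_one]
  have f_alg : ∀ i (c : ℂ), f i (algebraMap ℂ _ c) = 0 := fun i c => by
    simp [Algebra.algebraMap_eq_smul_one, f_one]
  have k_comm : ∀ i j a, k i (k j a) = k j (k i a) := by
    intro i j a
    have : ((k i : QSpace q n →ₐ[ℂ] QSpace q n).comp (k j : QSpace q n →ₐ[ℂ] QSpace q n)) =
        ((k j : QSpace q n →ₐ[ℂ] QSpace q n).comp (k i : QSpace q n →ₐ[ℂ] QSpace q n)) :=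
      algHom_ext_Xg (by simpa using hk i j)
    simpa using DFunLike.congr_fun this a
  have ks_comm : ∀ i j a, k i ((k j).symm a) = (k j).symm (k i a) := by
    intro i j a
    rw [AlgEquiv.eq_symm_apply, k_comm j i, AlgEquiv.apply_symm_apply]
  have ke : ∀ i j a, k i (e j a) = q ^ cartan m i j • e j (k i a) := by
    intro i j a
    rw [← sub_eq_zero]
    refine skewDerivation_eq_zero (k i) (fun b => k i (k j b))
      (fun a => k i (e j a) - q ^ cartan m i j • e j (k i a)) ?_ ?_ ?_ ?_ a
    · intro a b; simp; abel
    · intro c; simp [e_alg]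
    · intro a b
      simp only [e_mul, map_add, map_mul, k_comm i j, mul_sub, sub_mul, smul_add,
        mul_smul_comm, smul_mul_assoc]
      abel
    · intro t; simp [hke]
  have kf : ∀ i j a, k i (f j a) = q ^ (-cartan m i j) • f j (k i a) := by
    intro i j a
    rw [← sub_eq_zero]
    refine skewDerivation_eq_zero (fun b => k i ((k j).symm b)) (k i)
      (fun a => k i (f j a) - q ^ (-cartan m i j) • f j (k i a)) ?_ ?_ ?_ ?_ a
    · intro a b; simp; abel
    · intro c; simp [f_alg]
    · intro a b
      simp only [f_mul, map_add, map_mul, ks_comm i j, mul_sub, sub_mul, smul_add,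
        mul_smul_comm, smul_mul_assoc]
      abel
    · intro t; simp [hkf]
  have eks : ∀ i j a, e j ((k i).symm a) = q ^ cartan m i j • (k i).symm (e j a) := by
    intro i j a
    rw [← map_smul, AlgEquiv.eq_symm_apply, ke, AlgEquiv.apply_symm_apply]
  have fks : ∀ i j a, f j ((k i).symm a) = q ^ (-cartan m i j) • (k i).symm (f j a) := by
    intro i j a
    rw [← map_smul, AlgEquiv.eq_symm_apply, kf, AlgEquiv.apply_symm_apply]
  have hii : ∀ i, cartan m i i = 2 := fun i => by simp [cartan]
  have ef : ∀ i j a, e i (f j a) - f j (e i a) =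
      if i = j then (q - q⁻¹)⁻¹ • (k i a - (k i).symm a) else 0 := by
    intro i j a
    rw [← sub_eq_zero]
    refine skewDerivation_eq_zero ((k j).symm) (k i)
      (fun a => e i (f j a) - f j (e i a) -
        if i = j then (q - q⁻¹)⁻¹ • (k i a - (k i).symm a) else 0) ?_ ?_ ?_ ?_ a
    · intro a b
      split_ifs <;> simp only [map_add, smul_add, smul_sub] <;> abel
    · intro c; simp [f_alg, e_alg]
    · intro a b
      have hcross : e i ((k j).symm a) * k i (f j b) = (k j).symm (e i a) * f j (k i b) := by
        rw [eks, kf, hsymm j i, smul_mul_smul_comm, ← zpow_add₀ hq]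
        simp
      simp only [f_mul, e_mul, map_add, hcross]
      split_ifs with hij
      · subst hij
        simp only [map_mul, mul_sub, sub_mul, smul_sub, mul_smul_comm, smul_mul_assoc]
        abel
      · simp only [mul_sub, sub_mul, mul_zero, zero_mul]
        abel
    · intro t; simp [hef]
  have serre_e : ∀ i j, cartan m i j = -1 → ∀ a,
      e i (e i (e j a)) - (q + q⁻¹) • e i (e j (e i a)) + e j (e i (e i a)) = 0 := by
    intro i j hij a
    have hji := (hsymm j i).trans hij
    refine skewDerivation_eq_zero id (fun b => k i (k i (k j b)))
      (fun a => e i (e i (e j a)) - (q + q⁻¹) • e i (e j (e i a)) + e j (e i (e i a)))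
      ?_ ?_ ?_ (he i j hij) a
    · intro a b; simp only [map_add, smul_add]; abel
    · intro c; simp [e_alg]
    · intro a b
      simp only [e_mul, map_add, map_smul, ke, hij, hji, hii, k_comm j i, id, smul_add, mul_add,
        add_mul, mul_sub, sub_mul, mul_smul_comm, smul_mul_assoc]
      match_scalars <;> field_simp <;> ring
  have serre_f : ∀ i j, cartan m i j = -1 → ∀ a,
      f i (f i (f j a)) - (q + q⁻¹) • f i (f j (f i a)) + f j (f i (f i a)) = 0 := by
    intro i j hij a
    have hji := (hsymm j i).trans hij
    have kss_comm : ∀ a, (k j).symm ((k i).symm a) = (k i).symm ((k j).symm a) := by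
      intro a
      rw [AlgEquiv.eq_symm_apply, ks_comm, AlgEquiv.apply_symm_apply]
    refine skewDerivation_eq_zero (fun b => (k i).symm ((k i).symm ((k j).symm b))) id
      (fun a => f i (f i (f j a)) - (q + q⁻¹) • f i (f j (f i a)) + f j (f i (f i a)))
      ?_ ?_ ?_ (hf i j hij) a
    · intro a b; simp only [map_add, smul_add]; abel
    · intro c; simp [f_alg]
    · intro a b
      simp only [f_mul, map_add, map_smul, fks, hij, hji, hii, kss_comm, id, neg_neg, zpow_one,
        smul_add, mul_add,
        add_mul, mul_sub, sub_mul, mul_smul_comm, smul_mul_assoc]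
      match_scalars <;> field_simp <;> ring
  exact ⟨{
    k := k, e := e, f := f, e_mul := e_mul, f_mul := f_mul, e_one := e_one, f_one := f_one
    k_comm := k_comm
    ke := fun i j a => by rw [ke, AlgEquiv.apply_symm_apply]
    kf := fun i j a => by rw [kf, AlgEquiv.apply_symm_apply]
    ef := ef
    ee_comm := fun i j h => absurd h (hcartan i j)
    ff_comm := fun i j h => absurd h (hcartan i j)
    serre_e := serre_e, serre_f := serre_f }, rfl, rfl, rfl⟩

theorem forall_lt_fin_three {P : Fin 3 → Fin 3 → Prop} :
    (∀ i j, j < i → P i j) ↔ P 1 0 ∧ P 2 0 ∧ P 2 1 := by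
  refine ⟨fun h => ⟨h _ _ (by decide), h _ _ (by decide), h _ _ (by decide)⟩, ?_⟩
  rintro ⟨h10, h20, h21⟩ i j hij
  fin_cases i <;> fin_cases j <;> first | assumption | exact absurd hij (by decide)

theorem forall_fin_three {P : Fin 3 → Prop} : (∀ i, P i) ↔ P 0 ∧ P 1 ∧ P 2 := by
  simp [Fin.forall_fin_succ]

theorem Xg_zero (q : ℂ) : Xg q 3 0 = Z1 q := rfl
theorem Xg_one (q : ℂ) : Xg q 3 1 = Z2 q := rfl
theorem Xg_two (q : ℂ) : Xg q 3 2 = Z3 q := rfl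

theorem cartan_two : cartan 2 0 0 = 2 ∧ cartan 2 0 1 = -1 ∧ cartan 2 1 0 = -1 ∧
    cartan 2 1 1 = 2 := by
  decide

theorem exists_uqslMA_A2B3 {q : ℂ} (hq : q ≠ 0) (hq' : ∀ N : ℕ, 0 < N → q ^ N ≠ 1) {a₀ f₀ : ℂ}
    (ha : a₀ ≠ 0) (hf : f₀ ≠ 0) :
    ∃ π : UqslMA q 2 (QSpace q 3), KCond12 q π ∧ EFDesc12 q π a₀ f₀ := by
  let Q : ℂˣ := Units.mk0 q hq
  obtain ⟨k₀, k₀1, k₀2, k₀3, s₀1, s₀2, s₀3⟩ : ∃ k : QSpace q 3 ≃ₐ[ℂ] QSpace q 3,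
      k (Z1 q) = (q ^ (-2 : ℤ)) • Z1 q ∧ k (Z2 q) = q⁻¹ • Z2 q ∧ k (Z3 q) = q⁻¹ • Z3 q ∧
      k.symm (Z1 q) = (q ^ (2 : ℤ)) • Z1 q ∧ k.symm (Z2 q) = q • Z2 q ∧
      k.symm (Z3 q) = q • Z3 q :=
    ⟨diag q ![Q ^ (-2 : ℤ), Q⁻¹, Q⁻¹], by simp [Z1, Z2, Z3, Q]⟩
  obtain ⟨k₁, k₁1, k₁2, k₁3, s₁1, s₁2, s₁3⟩ : ∃ k : QSpace q 3 ≃ₐ[ℂ] QSpace q 3,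
      k (Z1 q) = q • Z1 q ∧ k (Z2 q) = q • Z2 q ∧ k (Z3 q) = q ^ 2 • Z3 q ∧
      k.symm (Z1 q) = q⁻¹ • Z1 q ∧ k.symm (Z2 q) = q⁻¹ • Z2 q ∧
      k.symm (Z3 q) = (q ^ 2)⁻¹ • Z3 q :=
    ⟨diag q ![Q, Q, Q ^ 2], by simp [Z1, Z2, Z3, Q]⟩
  obtain ⟨e₀, he₀, e₀_mul⟩ := exists_skewDerivation (AlgHom.id ℂ (QSpace q 3)) k₀
    ![a₀ • 1, 0, 0] <| by
      rw [forall_lt_fin_three]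
      refine ⟨?_, ?_, ?_⟩ <;>
      simp [Xg_zero, Xg_one, Xg_two, k₀1, k₀2, k₀3, smul_smul, hq]
  obtain ⟨e₁, he₁, e₁_mul⟩ := exists_skewDerivation (AlgHom.id ℂ (QSpace q 3)) k₁
    ![(-q * f₀⁻¹) • (Z1 q * Z3 q), (-q * f₀⁻¹) • (Z2 q * Z3 q), (-q * f₀⁻¹) • (Z3 q ^ 2)] <| by
      rw [forall_lt_fin_three]
      refine ⟨?_, ?_, ?_⟩ <;>
      simp [Xg_zero, Xg_one, Xg_two, k₁1, k₁2, k₁3, pow_two, mul_assoc,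
        Z3_mul_Z1, Z3_mul_Z2, Z2_mul_Z1_mul, Z3_mul_Z1_mul, Z3_mul_Z2_mul] <;>
      match_scalars <;> ring
  obtain ⟨f₀', hf₀, f₀_mul⟩ := exists_skewDerivation k₀.symm (AlgHom.id ℂ (QSpace q 3))
    ![(-q * a₀⁻¹) • (Z1 q ^ 2), (-q * a₀⁻¹) • (Z1 q * Z2 q), (-q * a₀⁻¹) • (Z1 q * Z3 q)] <| by
      rw [forall_lt_fin_three]
      refine ⟨?_, ?_, ?_⟩ <;>
      simp [Xg_zero, Xg_one, Xg_two, s₀1, s₀2, s₀3, pow_two, mul_assoc,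
        Z2_mul_Z1, Z3_mul_Z1, Z3_mul_Z2, Z2_mul_Z1_mul, Z3_mul_Z1_mul] <;>
      match_scalars <;> ring
  obtain ⟨f₁, hf₁, f₁_mul⟩ := exists_skewDerivation k₁.symm (AlgHom.id ℂ (QSpace q 3))
    ![0, 0, f₀ • 1] <| by
      rw [forall_lt_fin_three]
      refine ⟨?_, ?_, ?_⟩ <;>
      simp [Xg_zero, Xg_one, Xg_two, s₁1, s₁2, s₁3, smul_smul, hq,
        mul_left_comm q]
  simp only [forall_fin_three, Xg_zero, Xg_one, Xg_two, Matrix.cons_val] at he₀ he₁ hf₀ hf₁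
  simp only [AlgHom.coe_id, id_eq, AlgEquiv.coe_toAlgHom] at e₀_mul e₁_mul f₀_mul f₁_mul
  obtain ⟨e₀1, e₀2, e₀3⟩ := he₀
  obtain ⟨e₁1, e₁2, e₁3⟩ := he₁
  obtain ⟨f₀1, f₀2, f₀3⟩ := hf₀
  obtain ⟨f₁1, f₁2, f₁3⟩ := hf₁
  have e₀_one : e₀ 1 = 0 := by simpa using e₀_mul 1 1
  have e₁_one : e₁ 1 = 0 := by simpa using e₁_mul 1 1
  have f₀_one : f₀' 1 = 0 := by simpa using f₀_mul 1 1
  have f₁_one : f₁ 1 = 0 := by simpa using f₁_mul 1 1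
  have hc := sub_ne_zero.2 (hq' 2 (by norm_num))
  obtain ⟨c00, c01, c10, c11⟩ := cartan_two
  obtain ⟨π, hk, he, hf⟩ := exists_uqslMA hq ![k₀, k₁] ![e₀, e₁] ![f₀', f₁]
    (by simpa [Fin.forall_fin_two] using ⟨e₀_mul, e₁_mul⟩)
    (by simpa [Fin.forall_fin_two] using ⟨f₀_mul, f₁_mul⟩)
    (by
      simp only [Fin.forall_fin_two, forall_fin_three, Xg_zero, Xg_one, Xg_two, Matrix.cons_val]
      simp [k₀1, k₀2, k₀3, k₁1, k₁2, k₁3, smul_smul, mul_comm])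
    (by
      simp only [Fin.forall_fin_two, forall_fin_three, Xg_zero, Xg_one, Xg_two, Matrix.cons_val,
        c00, c01, c10, c11, k₀1, k₀2, k₀3, k₁1, k₁2, k₁3, e₀1, e₀2, e₀3, e₁1, e₁2, e₁3,
        map_smul, map_mul, map_pow, map_one, map_zero, smul_zero]
      refine ⟨⟨⟨?_, ?_, ?_⟩, ⟨?_, ?_, ?_⟩⟩, ⟨⟨?_, ?_, ?_⟩, ⟨?_, ?_, ?_⟩⟩⟩ <;>
      simp only [pow_two, mul_smul_comm, smul_mul_assoc, smul_smul] <;>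
      match_scalars <;> field_simp)
    (by
      simp only [Fin.forall_fin_two, forall_fin_three, Xg_zero, Xg_one, Xg_two, Matrix.cons_val,
        c00, c01, c10, c11, neg_neg, zpow_one, k₀1, k₀2, k₀3, k₁1, k₁2, k₁3,
        f₀1, f₀2, f₀3, f₁1, f₁2, f₁3,
        map_smul, map_mul, map_pow, map_one, map_zero, smul_zero]
      refine ⟨⟨⟨?_, ?_, ?_⟩, ⟨?_, ?_, ?_⟩⟩, ⟨⟨?_, ?_, ?_⟩, ⟨?_, ?_, ?_⟩⟩⟩ <;>
      simp only [pow_two, mul_smul_comm, smul_mul_assoc, smul_smul] <;>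
      match_scalars <;> field_simp)
    (by
      simp only [Fin.forall_fin_two, forall_fin_three, Xg_zero, Xg_one, Xg_two, Matrix.cons_val,
        k₀1, k₀2, k₀3, k₁1, k₁2, k₁3, s₀1, s₀2, s₀3, s₁1, s₁2, s₁3, pow_two,
        f₀1, f₀2, f₀3, f₁1, f₁2, f₁3, e₀1, e₀2, e₀3, e₁1, e₁2, e₁3, map_smul, map_zero,
        e₀_mul, e₁_mul, f₀_mul, f₁_mul, e₀_one, e₁_one,
        f₀_one, f₁_one, smul_zero, mul_zero, zero_mul]
      refine ⟨⟨⟨?_, ?_, ?_⟩, ⟨?_, ?_, ?_⟩⟩, ⟨⟨?_, ?_, ?_⟩, ⟨?_, ?_, ?_⟩⟩⟩ <;>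
      simp [mul_assoc, Z3_mul_Z1, Z3_mul_Z2,
        Z2_mul_Z1_mul, Z3_mul_Z1_mul, smul_smul] <;>
      match_scalars <;> field_simp <;> ring)
    (by simp [Fin.forall_fin_two, c00, c01, c10, c11])
    (by
      simp only [Fin.forall_fin_two, forall_fin_three, Xg_zero, Xg_one, Xg_two, Matrix.cons_val,
        c00, c01, c10, c11, forall_true_left, (by decide : ¬(2 : ℤ) = -1), IsEmpty.forall_iff,
        true_and, and_true, k₀3, k₁3, e₀1, e₀2, e₀3, e₁1, e₁2, e₁3, map_smul,
        map_zero, map_add, map_mul, pow_two, e₀_mul, e₁_mul, e₀_one, e₁_one, smul_zero,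
        mul_zero, zero_mul, zero_add, add_zero, sub_zero, smul_mul_assoc, mul_smul_comm, one_mul]
      match_scalars; field_simp; ring)
    (by
      simp only [Fin.forall_fin_two, forall_fin_three, Xg_zero, Xg_one, Xg_two, Matrix.cons_val,
        c00, c01, c10, c11, forall_true_left, (by decide : ¬(2 : ℤ) = -1), IsEmpty.forall_iff,
        true_and, and_true, s₀1, s₁1, f₀1, f₀2, f₀3, f₁1, f₁2, f₁3, map_smul,
        map_zero, map_add, map_mul, pow_two, f₀_mul, f₁_mul, f₀_one, f₁_one, smul_zero,
        mul_zero, zero_mul, add_zero, sub_zero, smul_mul_assoc, mul_smul_comm, mul_one]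
      match_scalars; field_simp; ring)
  refine ⟨π, ?_, ?_⟩
  · simp only [KCond12, hk, Matrix.cons_val]
    exact ⟨k₀1, k₀2, k₀3, k₁1, k₁2, k₁3⟩
  · simp only [EFDesc12, he, hf, Matrix.cons_val]
    exact ⟨e₀1, e₀2, e₀3, e₁1, e₁2, e₁3, f₀1, f₀2, f₀3, f₁1, f₁2, f₁3⟩

theorem zpow_injective_of_not_root {q : ℂ} (hq : q ≠ 0) (hq' : ∀ N : ℕ, 0 < N → q ^ N ≠ 1) :
    Function.Injective fun n : ℤ => q ^ n := by
  have key : ∀ m n : ℤ, m < n → q ^ m ≠ q ^ n := by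
    intro m n hmn h
    refine hq' (n - m).toNat (by omega) ?_
    rw [← zpow_natCast, Int.toNat_of_nonneg (by omega), zpow_sub₀ hq, h,
      div_self (zpow_ne_zero _ hq)]
  intro m n h
  rcases lt_trichotomy m n with hlt | heq | hgt
  · exact absurd h (key _ _ hlt)
  · exact heq
  · exact absurd h.symm (key _ _ hgt)

/-- A simultaneous eigenvector of `k_1`, `k_2` is supported on monomials of the given weight. -/
theorem eq_sum_of_weight {q : ℂ} (hq : q ≠ 0) (hq' : ∀ N : ℕ, 0 < N → q ^ N ≠ 1)
    {π : UqslMA q 2 (QSpace q 3)} (h : KCond12 q π) {u : QSpace q 3} {r s : ℤ}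
    (hr : π.k 0 u = q ^ r • u) (hs : π.k 1 u = q ^ s • u) (S : Finset (ℕ × ℕ × ℕ))
    (hS : ∀ a b c : ℕ, -(2 * a + b + c : ℤ) = r → (a + b + 2 * c : ℤ) = s → (a, b, c) ∈ S) :
    ∃ t : ℕ × ℕ × ℕ → ℂ, u = ∑ m ∈ S, t m • monomial q m := by
  obtain ⟨h01, h02, h03, h11, h12, h13⟩ := h
  refine ⟨_, eq_sum_monomial S ?_⟩
  rintro ⟨a, b, c⟩ hm
  have hinj := zpow_injective_of_not_root hq hq'
  apply hS
  · refine hinj (repr_of_eigenvector (π.k 0).toLinearMap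
      (fun m => q ^ (-(2 * m.1 + m.2.1 + m.2.2 : ℤ))) ?_ hr _ hm)
    rintro ⟨a, b, c⟩
    simp only [monomial, AlgEquiv.toLinearMap_apply, map_mul, map_pow, h01, h02, h03, smul_pow,
      smul_mul_smul_comm]
    congr 1
    rw [← zpow_neg_one, ← zpow_natCast, ← zpow_natCast, ← zpow_natCast, ← zpow_mul, ← zpow_mul,
      ← zpow_mul, ← zpow_add₀ hq, ← zpow_add₀ hq]
    congr 1
    ring
  · refine hinj (repr_of_eigenvector (π.k 1).toLinearMap
      (fun m => q ^ (m.1 + m.2.1 + 2 * m.2.2 : ℤ)) ?_ hs _ hm)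
    rintro ⟨a, b, c⟩
    simp only [monomial, AlgEquiv.toLinearMap_apply, map_mul, map_pow, h11, h12, h13, smul_pow,
      smul_mul_smul_comm]
    congr 1
    rw [← pow_mul, ← pow_add, ← pow_add, ← zpow_natCast]
    push_cast
    rfl

theorem k_e_eq {q : ℂ} (hq : q ≠ 0) {m : ℕ} {A : Type} [Ring A] [Algebra ℂ A] (π : UqslMA q m A)
    (i j : Fin m) {x : A} {r : ℤ} (h : π.k i x = q ^ r • x) :
    π.k i (π.e j x) = q ^ (cartan m i j + r) • π.e j x := by
  have := π.ke i j (π.k i x)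
  rwa [AlgEquiv.symm_apply_apply, h, map_smul, smul_smul, ← zpow_add₀ hq] at this

theorem k_f_eq {q : ℂ} (hq : q ≠ 0) {m : ℕ} {A : Type} [Ring A] [Algebra ℂ A] (π : UqslMA q m A)
    (i j : Fin m) {x : A} {r : ℤ} (h : π.k i x = q ^ r • x) :
    π.k i (π.f j x) = q ^ (-cartan m i j + r) • π.f j x := by
  have := π.kf i j (π.k i x)
  rwa [AlgEquiv.symm_apply_apply, h, map_smul, smul_smul, ← zpow_add₀ hq] at this

theorem symm_apply_of_smul {A : Type} [Ring A] [Algebra ℂ A] {k : A ≃ₐ[ℂ] A} {x : A} {c : ℂ}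
    (hc : c ≠ 0) (h : k x = c • x) : k.symm x = c⁻¹ • x := by
  rw [AlgEquiv.symm_apply_eq, map_smul, h, smul_smul, inv_mul_cancel₀ hc, one_smul]

theorem exists_EFDesc12 {q : ℂ} (hq : q ≠ 0) (hq' : ∀ N : ℕ, 0 < N → q ^ N ≠ 1)
    (π : UqslMA q 2 (QSpace q 3)) (h : KCond12 q π) :
    ∃ a₀ f₀ : ℂ, a₀ ≠ 0 ∧ f₀ ≠ 0 ∧ EFDesc12 q π a₀ f₀ := by
  obtain ⟨k₀1, k₀2, k₀3, k₁1, k₁2, k₁3⟩ := id h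
  obtain ⟨c00, c01, c10, c11⟩ := cartan_two
  have hX : ∃ r s : Fin 3 → ℤ, (r = ![-2, -1, -1] ∧ s = ![1, 1, 2]) ∧
      ∀ t, π.k 0 (Xg q 3 t) = q ^ r t • Xg q 3 t ∧ π.k 1 (Xg q 3 t) = q ^ s t • Xg q 3 t := by
    refine ⟨_, _, ⟨rfl, rfl⟩, ?_⟩
    simp only [forall_fin_three, Xg_zero, Xg_one, Xg_two, k₀1, k₀2, k₀3, k₁1, k₁2, k₁3]
    simp
  obtain ⟨r, s, ⟨rfl, rfl⟩, hX⟩ := hX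
  have he : ∀ (j : Fin 2) (t : Fin 3) (S : Finset (ℕ × ℕ × ℕ)),
      (∀ a b c : ℕ, -(2 * a + b + c : ℤ) = cartan 2 0 j + (![-2, -1, -1] : Fin 3 → ℤ) t →
        (a + b + 2 * c : ℤ) = cartan 2 1 j + (![1, 1, 2] : Fin 3 → ℤ) t → (a, b, c) ∈ S) →
      ∃ w : ℕ × ℕ × ℕ → ℂ, π.e j (Xg q 3 t) = ∑ m ∈ S, w m • monomial q m := fun j t =>
    eq_sum_of_weight hq hq' h (k_e_eq hq π 0 j (hX t).1) (k_e_eq hq π 1 j (hX t).2)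
  have hf : ∀ (j : Fin 2) (t : Fin 3) (S : Finset (ℕ × ℕ × ℕ)),
      (∀ a b c : ℕ, -(2 * a + b + c : ℤ) = -cartan 2 0 j + (![-2, -1, -1] : Fin 3 → ℤ) t →
        (a + b + 2 * c : ℤ) = -cartan 2 1 j + (![1, 1, 2] : Fin 3 → ℤ) t → (a, b, c) ∈ S) →
      ∃ w : ℕ × ℕ × ℕ → ℂ, π.f j (Xg q 3 t) = ∑ m ∈ S, w m • monomial q m := fun j t =>
    eq_sum_of_weight hq hq' h (k_f_eq hq π 0 j (hX t).1) (k_f_eq hq π 1 j (hX t).2)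
  obtain ⟨α, e₀1⟩ : ∃ α : ℂ, π.e 0 (Z1 q) = α • 1 := by
    obtain ⟨w, hw⟩ := he 0 0 {(0, 0, 0)} (by simp [c00, c10]; omega)
    exact ⟨_, by simpa [monomial, Xg_zero] using hw⟩
  have e₀2 : π.e 0 (Z2 q) = 0 := by
    obtain ⟨w, hw⟩ := he 0 1 ∅ (by simp [c00, c10]; omega)
    simpa [Xg_one] using hw
  have e₀3 : π.e 0 (Z3 q) = 0 := by
    obtain ⟨w, hw⟩ := he 0 2 ∅ (by simp [c00, c10]; omega)
    simpa [Xg_two] using hw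
  obtain ⟨β, γ, e₁1⟩ : ∃ β γ : ℂ, π.e 1 (Z1 q) = β • (Z1 q * Z3 q) + γ • Z2 q ^ 3 := by
    obtain ⟨w, hw⟩ := he 1 0 {(1, 0, 1), (0, 3, 0)} (by simp [c01, c11]; omega)
    exact ⟨_, _, by simpa [monomial, Xg_zero] using hw⟩
  obtain ⟨δ, e₁2⟩ : ∃ δ : ℂ, π.e 1 (Z2 q) = δ • (Z2 q * Z3 q) := by
    obtain ⟨w, hw⟩ := he 1 1 {(0, 1, 1)} (by simp [c01, c11]; omega)
    exact ⟨_, by simpa [monomial, Xg_one] using hw⟩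
  obtain ⟨ε, e₁3⟩ : ∃ ε : ℂ, π.e 1 (Z3 q) = ε • Z3 q ^ 2 := by
    obtain ⟨w, hw⟩ := he 1 2 {(0, 0, 2)} (by simp [c01, c11]; omega)
    exact ⟨_, by simpa [monomial, Xg_two] using hw⟩
  obtain ⟨ε', f₀1⟩ : ∃ ε' : ℂ, π.f 0 (Z1 q) = ε' • Z1 q ^ 2 := by
    obtain ⟨w, hw⟩ := hf 0 0 {(2, 0, 0)} (by simp [c00, c10]; omega)
    exact ⟨_, by simpa [monomial, Xg_zero] using hw⟩
  obtain ⟨δ', f₀2⟩ : ∃ δ' : ℂ, π.f 0 (Z2 q) = δ' • (Z1 q * Z2 q) := by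
    obtain ⟨w, hw⟩ := hf 0 1 {(1, 1, 0)} (by simp [c00, c10]; omega)
    exact ⟨_, by simpa [monomial, Xg_one] using hw⟩
  obtain ⟨β', γ', f₀3⟩ : ∃ β' γ' : ℂ, π.f 0 (Z3 q) = β' • (Z1 q * Z3 q) + γ' • Z2 q ^ 3 := by
    obtain ⟨w, hw⟩ := hf 0 2 {(1, 0, 1), (0, 3, 0)} (by simp [c00, c10]; omega)
    exact ⟨_, _, by simpa [monomial, Xg_two] using hw⟩
  have f₁1 : π.f 1 (Z1 q) = 0 := by
    obtain ⟨w, hw⟩ := hf 1 0 ∅ (by simp [c01, c11]; omega)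
    simpa [Xg_zero] using hw
  have f₁2 : π.f 1 (Z2 q) = 0 := by
    obtain ⟨w, hw⟩ := hf 1 1 ∅ (by simp [c01, c11]; omega)
    simpa [Xg_one] using hw
  obtain ⟨φ, f₁3⟩ : ∃ φ : ℂ, π.f 1 (Z3 q) = φ • 1 := by
    obtain ⟨w, hw⟩ := hf 1 2 {(0, 0, 0)} (by simp [c01, c11]; omega)
    exact ⟨_, by simpa [monomial, Xg_two] using hw⟩
  have z1 : Z1 q ≠ 0 := by simpa [monomial] using monomial_ne_zero q (1, 0, 0)
  have z2 : Z2 q ≠ 0 := by simpa [monomial] using monomial_ne_zero q (0, 1, 0)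
  have z3 : Z3 q ≠ 0 := by simpa [monomial] using monomial_ne_zero q (0, 0, 1)
  have z2' : Z2 q ^ 4 ≠ 0 := by simpa [monomial] using monomial_ne_zero q (0, 4, 0)
  have hq2 : q ^ 2 - 1 ≠ 0 := sub_ne_zero.2 (hq' 2 (by norm_num))
  have hq4 : q ^ 2 + 1 ≠ 0 := by
    intro h0
    exact hq' 4 (by norm_num) (by linear_combination (q ^ 2 - 1) * h0)
  have s₀1 := symm_apply_of_smul (zpow_ne_zero _ hq) k₀1
  have s₀2 := symm_apply_of_smul (inv_ne_zero hq) k₀2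
  have s₀3 := symm_apply_of_smul (inv_ne_zero hq) k₀3
  have s₁1 := symm_apply_of_smul hq k₁1
  have s₁2 := symm_apply_of_smul hq k₁2
  have s₁3 := symm_apply_of_smul (pow_ne_zero _ hq) k₁3
  have smul_eq : ∀ {c d : ℂ} {x : QSpace q 3}, x ≠ 0 → c • x = d • x → c = d :=
    fun hx hcd => smul_left_injective ℂ hx hcd
  have hqi : q - q⁻¹ ≠ 0 := by
    intro h0
    apply hq2
    field_simp at h0
    linear_combination h0
  have hef : ∀ (i : Fin 2) (x : QSpace q 3) (c : ℂ), π.k i x = c • x → (π.k i).symm x = c⁻¹ • x →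
      π.e i (π.f i x) - π.f i (π.e i x) = ((q - q⁻¹)⁻¹ * (c - c⁻¹)) • x := by
    intro i x c hk hs
    rw [π.ef, if_pos rfl, hk, hs, mul_smul, sub_smul]
  have hε' : α * ε' = -q := by
    have := hef 0 _ _ k₀1 s₀1
    simp only [f₀1, e₀1, k₀1, map_smul, π.e_mul, π.f_one, pow_two, smul_zero,
      sub_zero, mul_smul_comm, smul_mul_assoc, one_mul, mul_one, ← add_smul, smul_smul] at this
    have := smul_eq z1 this
    field_simp at this
    exact mul_right_cancel₀ (mul_ne_zero hq4 hq2) (by linear_combination this)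
  have hδ' : α * δ' = -q := by
    have := hef 0 _ _ k₀2 s₀2
    simp only [f₀2, e₀1, e₀2, k₀2, map_smul, map_zero, π.e_mul,
      sub_zero, zero_add, mul_zero, mul_smul_comm, smul_mul_assoc, one_mul, smul_smul] at this
    have := smul_eq z2 this
    field_simp at this
    exact mul_right_cancel₀ hq2 (by linear_combination this)
  have hβ' : α * β' = -q := by
    have := hef 0 _ _ k₀3 s₀3
    simp only [f₀3, e₀1, e₀2, e₀3, k₀3, map_smul, map_zero, map_add, π.e_mul,
      smul_zero, sub_zero, zero_add, add_zero, mul_zero, zero_mul, mul_smul_comm, smul_mul_assoc,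
      one_mul, smul_smul, pow_succ, pow_zero] at this
    have := smul_eq z3 this
    field_simp at this
    exact mul_right_cancel₀ hq2 (by linear_combination this)
  have hε : ε * φ = -q := by
    have := hef 1 _ _ k₁3 s₁3
    simp only [f₁3, e₁3, s₁3, map_smul, π.f_mul, π.e_one, pow_two, smul_zero,
      zero_sub, mul_smul_comm, smul_mul_assoc, one_mul, mul_one, ← add_smul,
      ← neg_smul, smul_smul] at this
    have := smul_eq z3 this
    field_simp at this
    exact mul_right_cancel₀ (mul_ne_zero hq4 hq2) (by linear_combination -this)
  have hδ : δ * φ = -q := by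
    have := hef 1 _ _ k₁2 s₁2
    simp only [f₁2, f₁3, e₁2, s₁2, map_smul, map_zero, π.f_mul,
      zero_sub, add_zero, zero_mul, mul_smul_comm, mul_one,
      ← neg_smul, smul_smul] at this
    have := smul_eq z2 this
    field_simp at this
    linear_combination -this
  have hβ : β * φ = -q := by
    have := hef 1 _ _ k₁1 s₁1
    simp only [f₁1, f₁2, f₁3, e₁1, s₁1, map_smul, map_zero, map_add, π.f_mul,
      smul_zero, zero_sub, add_zero, mul_zero, zero_mul, mul_smul_comm, mul_one,
      ← neg_smul, smul_smul, pow_succ, pow_zero, π.f_one] at this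
    have := smul_eq z1 this
    field_simp at this
    linear_combination -this
  have hα0 : α ≠ 0 := by
    rintro rfl
    exact hq (by simpa using hε')
  have hφ0 : φ ≠ 0 := by
    rintro rfl
    exact hq (by simpa using hε)
  have hβδ : β = δ := mul_right_cancel₀ hφ0 (hβ.trans hδ.symm)
  have hβδ' : β' = δ' := mul_left_cancel₀ hα0 (hβ'.trans hδ'.symm)
  have hγ : γ = 0 := by
    have := congrArg (π.e 1) (Z2_mul_Z1 q)
    simp only [e₁1, e₁2, k₁1, k₁2, π.e_mul, map_smul, mul_add, add_mul, mul_assoc, pow_succ,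
      pow_zero, one_mul, mul_smul_comm, smul_mul_assoc, Z2_mul_Z1_mul, Z3_mul_Z1, Z3_mul_Z2,
      hβδ] at this
    have : (γ * (q ^ 2 - 1)) • Z2 q ^ 4 = (0 : ℂ) • Z2 q ^ 4 := by
      simp only [pow_succ, pow_zero, one_mul, mul_assoc]
      linear_combination (norm := module) -this
    simpa [hq2] using smul_eq z2' this
  have hγ' : γ' = 0 := by
    have := congrArg (π.f 0) (Z3_mul_Z2 q)
    rw [π.f_mul, map_smul, π.f_mul] at this
    simp only [f₀2, f₀3, s₀2, s₀3, mul_add, add_mul, mul_assoc, pow_succ,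
      pow_zero, one_mul, mul_smul_comm, smul_mul_assoc, Z2_mul_Z1_mul, Z3_mul_Z1_mul,
      Z3_mul_Z2,
      hβδ', inv_inv] at this
    have : (γ' * (q ^ 2 - 1)) • Z2 q ^ 4 = (0 : ℂ) • Z2 q ^ 4 := by
      simp only [pow_succ, pow_zero, one_mul, mul_assoc]
      linear_combination (norm := module) -this
    simpa [hq2] using smul_eq z2' this
  subst hβδ hβδ' hγ hγ'
  obtain rfl : ε = -q * φ⁻¹ := (eq_mul_inv_iff_mul_eq₀ hφ0).2 hε
  obtain rfl : β = -q * φ⁻¹ := (eq_mul_inv_iff_mul_eq₀ hφ0).2 hβ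
  obtain rfl : ε' = -q * α⁻¹ := (eq_mul_inv_iff_mul_eq₀ hα0).2 (by rw [mul_comm, hε'])
  obtain rfl : β' = -q * α⁻¹ := (eq_mul_inv_iff_mul_eq₀ hα0).2 (by rw [mul_comm, hβ'])
  rw [zero_smul, add_zero] at e₁1 f₀3
  exact ⟨α, φ, hα0, hφ0, e₀1, e₀2, e₀3, e₁1, e₁2, e₁3, f₀1, f₀2, f₀3, f₁1, f₁2, f₁3⟩
/-- Two structures with the same `k`-action agree up to rescaling of `x_1` and `x_3`. -/
theorem iso_of_EFDesc12 {q : ℂ} {π π' : UqslMA q 2 (QSpace q 3)} {a₀ f₀ : ℂ}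
    (ha : a₀ ≠ 0) (hf : f₀ ≠ 0) (h : KCond12 q π) (h' : KCond12 q π')
    (hd : EFDesc12 q π a₀ f₀) (hd' : EFDesc12 q π' 1 1) : π.Iso π' := by
  obtain ⟨k₀1, k₀2, k₀3, k₁1, k₁2, k₁3⟩ := h
  obtain ⟨k₀1', k₀2', k₀3', k₁1', k₁2', k₁3'⟩ := h'
  obtain ⟨e₀1, e₀2, e₀3, e₁1, e₁2, e₁3, f₀1, f₀2, f₀3, f₁1, f₁2, f₁3⟩ := hd
  obtain ⟨e₀1', e₀2', e₀3', e₁1', e₁2', e₁3', f₀1', f₀2', f₀3', f₁1', f₁2', f₁3'⟩ := hd'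
  obtain ⟨ψ, ψ1, ψ2, ψ3⟩ : ∃ ψ : QSpace q 3 ≃ₐ[ℂ] QSpace q 3,
      ψ (Z1 q) = a₀ • Z1 q ∧ ψ (Z2 q) = Z2 q ∧ ψ (Z3 q) = f₀ • Z3 q :=
    ⟨diag q ![Units.mk0 a₀ ha, 1, Units.mk0 f₀ hf], by simp [Z1, Z2, Z3]⟩
  have hk : ∀ i a, ψ (π.k i a) = π'.k i (ψ a) := by
    intro i a
    have : (ψ : QSpace q 3 →ₐ[ℂ] QSpace q 3).comp (π.k i : QSpace q 3 →ₐ[ℂ] QSpace q 3) =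
        (π'.k i : QSpace q 3 →ₐ[ℂ] QSpace q 3).comp (ψ : QSpace q 3 →ₐ[ℂ] QSpace q 3) := by
      apply algHom_ext_Xg
      revert i
      simp [Fin.forall_fin_two, forall_fin_three, Xg_zero, Xg_one, Xg_two, k₀1, k₀2, k₀3,
        k₁1, k₁2, k₁3, k₀1', k₀2', k₀3', k₁1', k₁2', k₁3', ψ1, ψ2, ψ3, smul_smul, mul_comm]
    simpa using DFunLike.congr_fun this a
  have hks : ∀ i a, ψ ((π.k i).symm a) = (π'.k i).symm (ψ a) := by
    intro i a
    rw [AlgEquiv.eq_symm_apply, ← hk, AlgEquiv.apply_symm_apply]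
  have he : ∀ i a, ψ (π.e i a) = π'.e i (ψ a) := by
    intro i a
    rw [← sub_eq_zero]
    refine skewDerivation_eq_zero ψ (fun b => π'.k i (ψ b))
      (fun a => ψ (π.e i a) - π'.e i (ψ a)) ?_ ?_ ?_ ?_ a
    · intro a b; simp only [map_add]; abel
    · intro c; simp [Algebra.algebraMap_eq_smul_one, π.e_one, π'.e_one]
    · intro a b
      simp only [π.e_mul, π'.e_mul, map_add, map_mul, hk, mul_sub, sub_mul]
      abel
    · revert i
      simp only [Fin.forall_fin_two, forall_fin_three, Xg_zero, Xg_one, Xg_two, sub_eq_zero,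
        e₀1, e₀2, e₀3, e₁1, e₁2, e₁3, e₀1', e₀2', e₀3', e₁1', e₁2', e₁3', ψ1, ψ2, ψ3, map_smul,
        map_mul, map_pow, map_one, map_zero]
      simp [smul_smul, pow_two, hf, mul_left_comm, mul_comm]
      module
  have hf' : ∀ i a, ψ (π.f i a) = π'.f i (ψ a) := by
    intro i a
    rw [← sub_eq_zero]
    refine skewDerivation_eq_zero (fun b => (π'.k i).symm (ψ b)) ψ
      (fun a => ψ (π.f i a) - π'.f i (ψ a)) ?_ ?_ ?_ ?_ a
    · intro a b; simp only [map_add]; abel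
    · intro c; simp [Algebra.algebraMap_eq_smul_one, π.f_one, π'.f_one]
    · intro a b
      simp only [π.f_mul, π'.f_mul, map_add, map_mul, hks, mul_sub, sub_mul]
      abel
    · revert i
      simp only [Fin.forall_fin_two, forall_fin_three, Xg_zero, Xg_one, Xg_two, sub_eq_zero,
        f₀1, f₀2, f₀3, f₁1, f₁2, f₁3, f₀1', f₀2', f₀3', f₁1', f₁2', f₁3', ψ1, ψ2, ψ3, map_smul,
        map_mul, map_pow, map_one, map_zero]
      simp [smul_smul, pow_two, ha, mul_left_comm, mul_comm]
      constructor
      · module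
      · rw [mul_right_comm a₀, mul_inv_cancel₀ ha, one_mul]
  refine ⟨ψ, ?_, ?_, ?_, ?_⟩ <;> intro i a
  · rw [hk, AlgEquiv.apply_symm_apply]
  · rw [hks, AlgEquiv.apply_symm_apply]
  · rw [he, AlgEquiv.apply_symm_apply]
  · rw [hf', AlgEquiv.apply_symm_apply]

end QSpace

/-- Classification of `U_q(sl(3))`-module-algebra structures on `A_q(3)` in case
`(A2)|(B3)`: description, converse existence, and isomorphism with the normalized one. -/
theorem Uqsl3_on_Aq3_A2B3 (q : ℂ) (hq : q ≠ 0)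
    (hq' : ∀ N : ℕ, 0 < N → q ^ N ≠ 1) :
    (∀ π : UqslMA q 2 (QSpace q 3), KCond12 q π →
      ∃ a₀ f₀ : ℂ, a₀ ≠ 0 ∧ f₀ ≠ 0 ∧ EFDesc12 q π a₀ f₀) ∧
    (∀ a₀ f₀ : ℂ, a₀ ≠ 0 → f₀ ≠ 0 →
      ∃ π : UqslMA q 2 (QSpace q 3), KCond12 q π ∧ EFDesc12 q π a₀ f₀) ∧
    (∀ π π' : UqslMA q 2 (QSpace q 3),
      KCond12 q π → KCond12 q π' → EFDesc12 q π' 1 1 → π.Iso π') := by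
  refine ⟨fun π h => QSpace.exists_EFDesc12 hq hq' π h,
    fun a₀ f₀ ha hf => QSpace.exists_uqslMA_A2B3 hq hq' ha hf, fun π π' h h' hd' => ?_⟩
  obtain ⟨a₀, f₀, ha, hf, hd⟩ := QSpace.exists_EFDesc12 hq hq' π h
  exact QSpace.iso_of_EFDesc12 ha hf h h' hd hd'
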